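/- Bounded privacy of the two-stage adaptive tabulation mechanism: Fix ρ > 0, γ ∈ (0,1), integer thresholds Θ_1 ≤ Θ_2 ≤ Θ_3, and four fixed partitions of the record domain into finitely many cells. Consider the two-stage adaptive tabulation mechanism that on input database x first outputs Y_0 = |x| + Z_0 with Z_0 ∼ N_Z(1/(2γρ)), then, depending on which thresholds Y_0 exceeds, selects one of the four partitions and outputs the vector of cell counts of x each perturbed by independent N_Z(1/(2(1−γ)ρ)) noise. For any two databases x, x' of the same size that differ by replacing exactly one record with another, and for all α ∈ (1,∞), the Rényi divergence of order α between the mechanism's output distributions on x and x' is at most 2(1−γ)ρ·α; in particular the mechanism satisfies bounded 2ρ-zCDP. -/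

import Mathlib

open scoped BigOperators ENNReal

/-- Rényi divergence of order `α` between two discrete distributions. -/
noncomputable def renyiDiv {β : Type*} (α : ℝ) (P Q : PMF β) : ℝ :=
  (α - 1)⁻¹ * Real.log (∑' b : β, (P b).toReal ^ α * (Q b).toReal ^ (1 - α))

/-- Two databases (multisets of records) are neighbors if their symmetric
difference contains exactly one record. -/
def Neighbor {I : Type*} [DecidableEq I] (x x' : Multiset I) : Prop :=
  ((x - x') + (x' - x)).card = 1

/-- A randomized mechanism `M` satisfies `ρ`-zCDP. -/
def zCDP {I β : Type*} [DecidableEq I] (M : Multiset I → PMF β) (ρ : ℝ) : Prop :=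
  ∀ x x' : Multiset I, Neighbor x x' → ∀ α : ℝ, 1 < α →
    renyiDiv α (M x) (M x') ≤ α * ρ

universe u

/-- Product of finitely many independent distributions, indexed by `Fin n`. -/
noncomputable def pmfPiFin : (n : ℕ) → (β : Fin n → Type u) →
    ((i : Fin n) → PMF (β i)) → PMF ((i : Fin n) → β i)
  | 0, _, _ => PMF.pure (fun i => i.elim0)
  | n + 1, β, p =>
      (p 0).bind fun b0 =>
        (pmfPiFin n (fun i => β i.succ) (fun i => p i.succ)).bind fun f =>
          PMF.pure (Fin.cons b0 f)

/-- Product of independent distributions indexed by a finite type. -/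
noncomputable def pmfPi {ι : Type*} [Fintype ι] {β : ι → Type*}
    (p : (i : ι) → PMF (β i)) : PMF ((i : ι) → β i) :=
  (pmfPiFin (Fintype.card ι) (fun k => β ((Fintype.equivFin ι).symm k))
      (fun k => p ((Fintype.equivFin ι).symm k))).map
    ⇑(Equiv.piCongrLeft' β (Fintype.equivFin ι)).symm

/-- Two databases are bounded neighbors if they are identical except that a single
record of one is replaced by a different record in the other (in particular they
contain the same number of records). -/
def BoundedNeighbor {I : Type*} (x x' : Multiset I) : Prop :=
  ∃ (z : Multiset I) (a b : I), a ≠ b ∧ x = a ::ₘ z ∧ x' = b ::ₘ z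

/-- A randomized mechanism `M` satisfies bounded `ρ`-zCDP. -/
def BoundedZCDP {I β : Type*} (M : Multiset I → PMF β) (ρ : ℝ) : Prop :=
  ∀ x x' : Multiset I, BoundedNeighbor x x' → ∀ α : ℝ, 1 < α →
    renyiDiv α (M x) (M x') ≤ α * ρ

open scoped ENNReal

/-- The (real-valued) unnormalized discrete Gaussian mass function. -/
noncomputable def dgaussMass (σ2 : ℝ) (y : ℤ) : ℝ :=
  Real.exp (-(y : ℝ) ^ 2 / (2 * σ2))

lemma dgaussMass_summable {σ2 : ℝ} (h : 0 < σ2) : Summable (dgaussMass σ2) := by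
  have h2 : (0 : ℝ) < 2 * σ2 := by linarith
  have hgeo : Summable fun n : ℕ => Real.exp ((n : ℝ) * (-(2 * σ2)⁻¹)) :=
    Real.summable_exp_nat_mul_iff.mpr (by rw [neg_lt_zero]; positivity)
  have hnat : Summable fun n : ℕ => dgaussMass σ2 (n : ℤ) := by
    apply Summable.of_nonneg_of_le (fun n => (Real.exp_pos _).le) ?_ hgeo
    intro n
    apply Real.exp_le_exp.mpr
    have hn : (n : ℝ) ≤ (n : ℝ) ^ 2 := by exact_mod_cast Nat.le_self_pow two_ne_zero n
    push_cast [dgaussMass]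
    rw [show (n : ℝ) * (-(2 * σ2)⁻¹) = -((n : ℝ) / (2 * σ2)) by ring,
      show -(n : ℝ) ^ 2 / (2 * σ2) = -((n : ℝ) ^ 2 / (2 * σ2)) by ring]
    apply neg_le_neg
    gcongr
  apply Summable.of_nat_of_neg hnat
  have : ∀ n : ℕ, dgaussMass σ2 (-(n : ℤ)) = dgaussMass σ2 (n : ℤ) := by
    intro n; simp [dgaussMass]
  simpa only [this] using hnat

lemma dgaussMass_pos (σ2 : ℝ) (y : ℤ) : 0 < dgaussMass σ2 y := Real.exp_pos _

lemma dgaussMass_tsum_pos {σ2 : ℝ} (h : 0 < σ2) : 0 < ∑' y : ℤ, dgaussMass σ2 y :=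
  (dgaussMass_summable h).tsum_pos (fun y => (dgaussMass_pos σ2 y).le) 0 (dgaussMass_pos σ2 0)

/-- The discrete Gaussian distribution `N_ℤ(σ²)` centered at `0`, as a `PMF` on `ℤ`
(defined to be a point mass when `σ² ≤ 0`). -/
noncomputable def dgaussPMF (σ2 : ℝ) : PMF ℤ :=
  if h : 0 < σ2 then
    ⟨fun x => ENNReal.ofReal (dgaussMass σ2 x / ∑' y : ℤ, dgaussMass σ2 y), by
      have hS : (0 : ℝ) < ∑' y : ℤ, dgaussMass σ2 y := dgaussMass_tsum_pos h
      have key : ∑' x : ℤ, ENNReal.ofReal (dgaussMass σ2 x / ∑' y : ℤ, dgaussMass σ2 y) = 1 := by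
        rw [← ENNReal.ofReal_tsum_of_nonneg (fun x => div_nonneg (dgaussMass_pos σ2 x).le hS.le)
          ((dgaussMass_summable h).div_const _), tsum_div_const, div_self hS.ne',
          ENNReal.ofReal_one]
      exact key ▸ ENNReal.summable.hasSum⟩
  else PMF.pure 0

/-- The two-stage adaptive tabulation mechanism with budget `ρ` and split `γ`:
first release a noisy total count `y0` of the database using discrete Gaussian noise of
variance `1/(2γρ)`; then, depending on which of the thresholds `Θ1 ≤ Θ2 ≤ Θ3` the noisy
count exceeds, select one of four fixed partitions of the record domain (partition `t`
has `n t` cells, given by `part t : I → Fin (n t)`) and release all of its cell counts,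
each perturbed by independent discrete Gaussian noise of variance `1/(2(1-γ)ρ)`. -/
noncomputable def twoStage {I : Type*} (n : Fin 4 → ℕ) (part : (t : Fin 4) → I → Fin (n t))
    (Θ1 Θ2 Θ3 : ℤ) (ρ γ : ℝ) (x : Multiset I) :
    PMF (ℤ × Σ t : Fin 4, (Fin (n t) → ℤ)) :=
  (dgaussPMF (1 / (2 * γ * ρ))).bind fun z0 =>
    let y0 : ℤ := (Multiset.card x : ℤ) + z0
    let t : Fin 4 := if y0 < Θ1 then 0 else if y0 < Θ2 then 1 else if y0 < Θ3 then 2 else 3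
    (pmfPi fun _ : Fin (n t) => dgaussPMF (1 / (2 * (1 - γ) * ρ))).bind fun noise =>
      PMF.pure (y0, ⟨t, fun c => ((x.filter fun r => part t r = c).card : ℤ) + noise c⟩)

open HurwitzZeta in
lemma gauss_shift {s : ℝ} (hs : 0 < s) (μ : ℝ) :
    (∑' z : ℤ, ENNReal.ofReal (Real.exp (-Real.pi * ((z : ℝ) + μ) ^ 2 * s))) ≤
    ∑' z : ℤ, ENNReal.ofReal (Real.exp (-Real.pi * (z : ℝ) ^ 2 * s)) := by
  have h1 := hasSum_int_evenKernel μ hs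
  have h0 := hasSum_int_evenKernel 0 hs
  simp only [add_zero] at h0
  rw [← ENNReal.ofReal_tsum_of_nonneg (fun _ => (Real.exp_pos _).le) h1.summable,
    ← ENNReal.ofReal_tsum_of_nonneg (fun _ => (Real.exp_pos _).le) h0.summable,
    h1.tsum_eq, h0.tsum_eq]
  apply ENNReal.ofReal_le_ofReal
  rw [evenKernel_functional_equation, evenKernel_functional_equation]
  have hs' : 0 < 1 / s := by positivity
  apply mul_le_mul_of_nonneg_left _ (by positivity)
  have c1 := hasSum_int_cosKernel μ hs'
  have c0 := hasSum_int_cosKernel 0 hs'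
  have c0' : HasSum (fun n : ℤ => Real.exp (-Real.pi * (n : ℝ) ^ 2 * (1 / s))) (cosKernel 0 (1 / s)) := by
    rw [← Complex.hasSum_ofReal]
    simpa using c0
  have := tsum_of_norm_bounded c0' (f := fun n : ℤ => Complex.exp (2 * Real.pi * Complex.I * μ * n) * (Real.exp (-Real.pi * (n : ℝ) ^ 2 * (1 / s)) : ℝ)) (by
    intro n
    rw [norm_mul, Complex.norm_exp, Complex.norm_real]
    simp)
  rw [c1.tsum_eq, Complex.norm_real] at this
  exact (le_abs_self _).trans this

/-- integrand of the Renyi moment -/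
noncomputable def rr (α : ℝ) (p q : ℝ≥0∞) : ℝ≥0∞ :=
  ENNReal.ofReal (p.toReal ^ α * q.toReal ^ (1 - α))

lemma rr_mul (α : ℝ) (p q p' q' : ℝ≥0∞) : rr α (p * p') (q * q') = rr α p q * rr α p' q' := by
  unfold rr
  rw [← ENNReal.ofReal_mul (by positivity), ENNReal.toReal_mul, ENNReal.toReal_mul,
    Real.mul_rpow ENNReal.toReal_nonneg ENNReal.toReal_nonneg,
    Real.mul_rpow ENNReal.toReal_nonneg ENNReal.toReal_nonneg]
  congr 1
  ring

lemma rr_one (α : ℝ) : rr α 1 1 = 1 := by simp [rr]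

lemma rr_zero {α : ℝ} (h : 1 < α) (q : ℝ≥0∞) : rr α 0 q = 0 := by
  have : α ≠ 0 := by linarith
  simp [rr, Real.zero_rpow this]

lemma rr_self {α : ℝ} (h : 1 < α) (p : ℝ≥0∞) : rr α p p ≤ p := by
  unfold rr
  rcases (ENNReal.toReal_nonneg (a := p)).eq_or_lt with h0 | h0
  · have : α ≠ 0 := by linarith
    rw [← h0, Real.zero_rpow this]; simp
  · rw [← Real.rpow_add h0]
    simp [ENNReal.ofReal_toReal_le]

lemma rr_prod (α : ℝ) {ι : Type*} (s : Finset ι) (f g : ι → ℝ≥0∞) :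
    rr α (∏ i ∈ s, f i) (∏ i ∈ s, g i) = ∏ i ∈ s, rr α (f i) (g i) := by
  classical
  induction s using Finset.induction_on with
  | empty => simp [rr_one]
  | insert a s ha ih => rw [Finset.prod_insert ha, Finset.prod_insert ha, Finset.prod_insert ha, rr_mul, ih]

lemma tsum_pi_prod (n : ℕ) (f : Fin n → ℤ → ℝ≥0∞) :
    ∑' v : Fin n → ℤ, ∏ c, f c (v c) = ∏ c, ∑' z, f c z := by
  induction n with
  | zero => simp
  | succ n ih =>
    rw [← (Fin.consEquiv (fun _ : Fin (n+1) => ℤ)).tsum_eq, ENNReal.tsum_prod']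
    simp only [Fin.prod_univ_succ, Fin.consEquiv, Equiv.coe_fn_mk, Fin.cons_zero, Fin.cons_succ]
    simp_rw [ENNReal.tsum_mul_left, ih, ENNReal.tsum_mul_right]

lemma pmfPiFin_apply (n : ℕ) (β : Fin n → Type u) (p : (i : Fin n) → PMF (β i))
    (v : (i : Fin n) → β i) : pmfPiFin n β p v = ∏ i, p i (v i) := by
  induction n with
  | zero =>
    simp only [pmfPiFin, Finset.univ_eq_empty, Finset.prod_empty]
    rw [Subsingleton.elim v (fun i => i.elim0), PMF.pure_apply_self]
  | succ n ih =>
    simp only [pmfPiFin, PMF.bind_apply, Fin.prod_univ_succ]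
    rw [tsum_eq_single (v 0), tsum_eq_single (fun i : Fin n => v (Fin.succ i))]
    · rw [ih]
      have : Fin.cons (v 0) (fun i => v i.succ) = v := Fin.cons_self_tail v
      rw [this, PMF.pure_apply_self, mul_one]
    · intro f hf
      rw [PMF.pure_apply, if_neg, mul_zero]
      intro h
      apply hf
      funext i
      rw [h]
      simp
    · intro b hb
      have : ∀ f : (i : Fin n) → β i.succ, (PMF.pure (Fin.cons b f : (i : Fin (n+1)) → β i)) v = 0 := by
        intro f
        rw [PMF.pure_apply, if_neg]
        rintro rfl
        simp at hb
      simp [this]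

lemma pmfPi_apply {ι : Type*} [Fintype ι] {β : ι → Type*}
    (p : (i : ι) → PMF (β i)) (v : (i : ι) → β i) : pmfPi p v = ∏ i, p i (v i) := by
  unfold pmfPi
  set e := Equiv.piCongrLeft' β (Fintype.equivFin ι)
  rw [PMF.map_apply, tsum_eq_single (e v)]
  · rw [if_pos (by simp), pmfPiFin_apply]
    exact (Fintype.equivFin ι).symm.prod_comp (fun i => p i (v i))
  · intro w hw
    rw [if_neg]
    rintro rfl
    simp at hw

lemma dgauss_apply {σ2 : ℝ} (h : 0 < σ2) (z : ℤ) :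
    dgaussPMF σ2 z = ENNReal.ofReal (dgaussMass σ2 z / ∑' y : ℤ, dgaussMass σ2 y) := by
  have e : dgaussPMF σ2 = _ := dif_pos h
  rw [e]
  rfl

lemma dgauss_rr {σ2 α : ℝ} (h : 0 < σ2) (a b : ℤ) :
    ∑' z : ℤ, rr α (dgaussPMF σ2 (z - a)) (dgaussPMF σ2 (z - b)) ≤
      ENNReal.ofReal (Real.exp (α * (α - 1) * ((a : ℝ) - b) ^ 2 / (2 * σ2))) := by
  set S := ∑' y : ℤ, dgaussMass σ2 y with hS
  have hSp : 0 < S := dgaussMass_tsum_pos h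
  set s : ℝ := 1 / (2 * Real.pi * σ2) with hs
  have hsp : 0 < s := by have := Real.pi_pos; positivity
  set μ : ℝ := -(α * a + (1 - α) * b)
  set K := Real.exp (α * (α - 1) * ((a : ℝ) - b) ^ 2 / (2 * σ2))
  have key : ∀ z : ℤ, rr α (dgaussPMF σ2 (z - a)) (dgaussPMF σ2 (z - b)) =
      ENNReal.ofReal (K / S) * ENNReal.ofReal (Real.exp (-Real.pi * ((z : ℝ) + μ) ^ 2 * s)) := by
    intro z
    unfold rr
    rw [← ENNReal.ofReal_mul (by positivity), dgauss_apply h, dgauss_apply h,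
      ENNReal.toReal_ofReal (div_nonneg (dgaussMass_pos _ _).le hSp.le),
      ENNReal.toReal_ofReal (div_nonneg (dgaussMass_pos _ _).le hSp.le),
      Real.div_rpow (dgaussMass_pos _ _).le hSp.le, Real.div_rpow (dgaussMass_pos _ _).le hSp.le,
      div_mul_div_comm, ← Real.rpow_add hSp, div_mul_eq_mul_div]
    congr 2
    · unfold dgaussMass
      rw [← Real.exp_mul, ← Real.exp_mul, ← Real.exp_add, ← Real.exp_add]
      congr 1
      have := Real.pi_pos
      simp only [hs, μ]
      push_cast
      field_simp
      ring
    · simp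
  simp_rw [key]
  rw [ENNReal.tsum_mul_left]
  refine (mul_le_mul_right (gauss_shift hsp μ) _).trans ?_
  have e : ∀ z : ℤ, Real.exp (-Real.pi * (z : ℝ) ^ 2 * s) = dgaussMass σ2 z := by
    intro z
    unfold dgaussMass
    congr 1
    have := Real.pi_pos
    simp only [hs]
    field_simp
  simp_rw [e]
  rw [← ENNReal.ofReal_tsum_of_nonneg (fun _ => (dgaussMass_pos _ _).le) (dgaussMass_summable h),
    ← hS, ← ENNReal.ofReal_mul (by positivity), div_mul_cancel₀ _ hSp.ne']

/-- partition selector -/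
def sel (Θ1 Θ2 Θ3 y0 : ℤ) : Fin 4 :=
  if y0 < Θ1 then 0 else if y0 < Θ2 then 1 else if y0 < Θ3 then 2 else 3

/-- cell counts -/
def cnt {I : Type*} {n : Fin 4 → ℕ} (part : (t : Fin 4) → I → Fin (n t)) (x : Multiset I)
    (t : Fin 4) (c : Fin (n t)) : ℤ := ((x.filter fun r => part t r = c).card : ℤ)

lemma twoStage_apply {I : Type*} (n : Fin 4 → ℕ) (part : (t : Fin 4) → I → Fin (n t))
    (Θ1 Θ2 Θ3 : ℤ) (ρ γ : ℝ) (x : Multiset I) (y : ℤ) (t : Fin 4) (v : Fin (n t) → ℤ) :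
    twoStage n part Θ1 Θ2 Θ3 ρ γ x (y, ⟨t, v⟩) =
      dgaussPMF (1 / (2 * γ * ρ)) (y - (Multiset.card x : ℤ)) *
        ((if t = sel Θ1 Θ2 Θ3 y then 1 else 0) *
          ∏ c, dgaussPMF (1 / (2 * (1 - γ) * ρ)) (v c - cnt part x t c)) := by
  have hdef : twoStage n part Θ1 Θ2 Θ3 ρ γ x = (dgaussPMF (1 / (2 * γ * ρ))).bind fun z0 =>
      (pmfPi fun _ : Fin (n (sel Θ1 Θ2 Θ3 ((Multiset.card x : ℤ) + z0))) =>
        dgaussPMF (1 / (2 * (1 - γ) * ρ))).bind fun noise =>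
      PMF.pure ((Multiset.card x : ℤ) + z0, ⟨sel Θ1 Θ2 Θ3 ((Multiset.card x : ℤ) + z0),
        fun c => cnt part x _ c + noise c⟩) := rfl
  rw [hdef, PMF.bind_apply, tsum_eq_single (y - (Multiset.card x : ℤ))]
  · congr 1
    rw [add_sub_cancel, PMF.bind_apply]
    by_cases ht : t = sel Θ1 Θ2 Θ3 y
    · subst ht
      rw [if_pos rfl, one_mul, tsum_eq_single (fun c => v c - cnt part x _ c)]
      · rw [pmfPi_apply]
        simp
      · intro w hw
        rw [PMF.pure_apply, if_neg, mul_zero]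
        intro h
        apply hw
        simp only [Prod.mk.injEq, Sigma.mk.injEq, heq_eq_eq, true_and] at h
        rw [h]
        funext c
        simp
    · rw [if_neg ht, zero_mul, ENNReal.tsum_eq_zero]
      intro w
      rw [PMF.pure_apply, if_neg, mul_zero]
      intro h
      apply ht
      simp only [Prod.mk.injEq, Sigma.mk.injEq] at h
      exact h.2.1
  · intro z hz
    rw [mul_eq_zero]
    right
    rw [PMF.bind_apply, ENNReal.tsum_eq_zero]
    intro w
    rw [PMF.pure_apply, if_neg, mul_zero]
    intro h
    apply hz
    have := congrArg Prod.fst h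
    simp only at this
    omega

lemma cnt_sq {I : Type*} {n : Fin 4 → ℕ} (part : (t : Fin 4) → I → Fin (n t)) (z : Multiset I)
    (a b : I) (t : Fin 4) :
    ∑ c, ((cnt part (a ::ₘ z) t c : ℝ) - (cnt part (b ::ₘ z) t c : ℝ)) ^ 2 ≤ 2 := by
  have h : ∀ c, ((cnt part (a ::ₘ z) t c : ℝ) - (cnt part (b ::ₘ z) t c : ℝ)) ^ 2 ≤
      (if part t a = c then 1 else 0) + (if part t b = c then 1 else 0) := by
    intro c
    unfold cnt
    by_cases h1 : part t a = c <;> by_cases h2 : part t b = c <;> simp [h1, h2]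
  refine (Finset.sum_le_sum fun c _ => h c).trans ?_
  rw [Finset.sum_add_distrib]
  simp
  norm_num

lemma renyi_le {β : Type*} {α C : ℝ} (hα : 1 < α) (hC : 0 ≤ C) (P Q : PMF β)
    (h : ∑' b, rr α (P b) (Q b) ≤ ENNReal.ofReal (Real.exp ((α - 1) * C))) :
    renyiDiv α P Q ≤ C := by
  have e : ∑' b : β, (P b).toReal ^ α * (Q b).toReal ^ (1 - α) =
      (∑' b, rr α (P b) (Q b)).toReal := by
    rw [ENNReal.tsum_toReal_eq (f := fun b => rr α (P b) (Q b)) (fun b => by simp [rr])]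
    congr 1
    funext b
    rw [rr, ENNReal.toReal_ofReal (by positivity)]
  have h2 := ENNReal.toReal_mono ENNReal.ofReal_ne_top h
  rw [ENNReal.toReal_ofReal (Real.exp_pos _).le, ← e] at h2
  have hα' : 0 < α - 1 := by linarith
  unfold renyiDiv
  rw [inv_mul_le_iff₀ hα']
  set T := ∑' b : β, (P b).toReal ^ α * (Q b).toReal ^ (1 - α)
  have hT : 0 ≤ T := tsum_nonneg fun b => by positivity
  rcases hT.eq_or_lt with h0 | h0
  · rw [← h0, Real.log_zero]; positivity
  · rwa [Real.log_le_iff_le_exp h0]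

/-- Bounded privacy of the two-stage adaptive tabulation mechanism:
for any two databases of the same size that differ by replacing exactly one record with
another, the order-`α` Rényi divergence between the output distributions is at most
`2(1-γ)ρ·α`; in particular, the mechanism satisfies bounded `2ρ`-zCDP. -/
theorem twoStage_bounded_zCDP {I : Type*} [DecidableEq I]
    (ρ γ : ℝ) (hρ : 0 < ρ) (hγ0 : 0 < γ) (hγ1 : γ < 1)
    (Θ1 Θ2 Θ3 : ℤ) (hΘ12 : Θ1 ≤ Θ2) (hΘ23 : Θ2 ≤ Θ3)
    (n : Fin 4 → ℕ) (part : (t : Fin 4) → I → Fin (n t)) :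
    (∀ x x' : Multiset I, BoundedNeighbor x x' → ∀ α : ℝ, 1 < α →
        renyiDiv α (twoStage n part Θ1 Θ2 Θ3 ρ γ x) (twoStage n part Θ1 Θ2 Θ3 ρ γ x') ≤
          2 * (1 - γ) * ρ * α) ∧
      BoundedZCDP (twoStage n part Θ1 Θ2 Θ3 ρ γ) (2 * ρ) := by
  have main : ∀ x x' : Multiset I, BoundedNeighbor x x' → ∀ α : ℝ, 1 < α →
        renyiDiv α (twoStage n part Θ1 Θ2 Θ3 ρ γ x) (twoStage n part Θ1 Θ2 Θ3 ρ γ x') ≤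
          2 * (1 - γ) * ρ * α := by
    rintro x x' ⟨z, a, b, -, rfl, rfl⟩ α hα
    have hγ : 0 < 1 - γ := by linarith
    have hα0 : 0 < α - 1 := by linarith
    have hσ : 0 < 1 / (2 * (1 - γ) * ρ) := by positivity
    apply renyi_le hα (by positivity)
    set K := ENNReal.ofReal (Real.exp ((α - 1) * (2 * (1 - γ) * ρ * α))) with hK
    have inner : ∀ t : Fin 4, ∑' v : Fin (n t) → ℤ, ∏ c,
        rr α (dgaussPMF (1 / (2 * (1 - γ) * ρ)) (v c - cnt part (a ::ₘ z) t c))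
          (dgaussPMF (1 / (2 * (1 - γ) * ρ)) (v c - cnt part (b ::ₘ z) t c)) ≤ K := by
      intro t
      rw [tsum_pi_prod (n t) (fun c y =>
        rr α (dgaussPMF (1 / (2 * (1 - γ) * ρ)) (y - cnt part (a ::ₘ z) t c))
          (dgaussPMF (1 / (2 * (1 - γ) * ρ)) (y - cnt part (b ::ₘ z) t c)))]
      refine (Finset.prod_le_prod' fun c _ => dgauss_rr hσ _ _).trans ?_
      rw [← ENNReal.ofReal_prod_of_nonneg (fun _ _ => (Real.exp_pos _).le), ← Real.exp_sum]
      apply ENNReal.ofReal_le_ofReal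
      apply Real.exp_le_exp.mpr
      rw [← Finset.sum_div, ← Finset.mul_sum]
      have h2 := cnt_sq part z a b t
      have h3 : 0 ≤ α * (α - 1) * ((1 - γ) * ρ) := by positivity
      have h4 := mul_le_mul_of_nonneg_left h2 h3
      calc _ = α * (α - 1) * ((1 - γ) * ρ) * ∑ c, ((cnt part (a ::ₘ z) t c : ℝ) -
              (cnt part (b ::ₘ z) t c : ℝ)) ^ 2 := by
            field_simp
        _ ≤ _ := h4
        _ = _ := by ring
    rw [ENNReal.tsum_prod']
    simp_rw [ENNReal.tsum_sigma', twoStage_apply, rr_mul, rr_prod, Multiset.card_cons,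
      ENNReal.tsum_mul_left]
    calc _ ≤ ∑' y : ℤ, dgaussPMF (1 / (2 * γ * ρ)) (y - ((Multiset.card z + 1 : ℕ) : ℤ)) * K := by
          apply ENNReal.tsum_le_tsum
          intro y
          refine mul_le_mul' (rr_self hα _) ?_
          rw [tsum_eq_single (sel Θ1 Θ2 Θ3 y)]
          · rw [if_pos rfl, rr_one, one_mul]
            exact inner _
          · intro t ht
            rw [if_neg ht, rr_zero hα, zero_mul]
      _ = K := by
          have hh := (Equiv.subRight ((Multiset.card z + 1 : ℕ) : ℤ)).tsum_eq
              (fun y => dgaussPMF (1 / (2 * γ * ρ)) y)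
          simp only [Equiv.subRight_apply] at hh
          rw [ENNReal.tsum_mul_right, hh, PMF.tsum_coe, one_mul]
  refine ⟨main, fun x x' h α hα => (main x x' h α hα).trans ?_⟩
  have : 0 ≤ γ * ρ * α := by positivity
  nlinarith
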